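/- Equivalently in the free group: for every integer k ≥ 1 and all signs ε₁, δ₁, …, ε_k, δ_k ∈ {1, −1}, the element a^{ε₁} b^{δ₁} ⋯ a^{ε_k} b^{δ_k} of the free group F₂ on two generators a, b does not belong to the second derived subgroup of F₂ (the derived subgroup of the derived subgroup). -/

import Mathlib

theorem DihedralGroup.r_mem_zpowers {n : ℕ} (i : ZMod n) :
    DihedralGroup.r i ∈ Subgroup.zpowers (DihedralGroup.r (1 : ZMod n)) := by
  obtain ⟨m, rfl⟩ := ZMod.intCast_surjective i
  exact ⟨m, by simp⟩

theorem DihedralGroup.derivedSeries_two_eq_bot (n : ℕ) :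
    derivedSeries (DihedralGroup n) 2 = ⊥ := by
  have h : derivedSeries (DihedralGroup n) 1 ≤
      Subgroup.zpowers (DihedralGroup.r (1 : ZMod n)) := by
    rw [derivedSeries_one, commutator_def, Subgroup.commutator_le]
    rintro (i | i) - (j | j) - <;>
      simp [commutatorElement_def, -DihedralGroup.r_zpow, DihedralGroup.r_mem_zpowers]
  rw [derivedSeries_succ, eq_bot_iff]
  refine (Subgroup.commutator_mono h h).trans ?_
  rw [Subgroup.commutator_le]
  intro x hx y hy
  rw [Subgroup.mem_bot, commutatorElement_eq_one_iff_mul_comm]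
  exact setLike_mul_comm hx hy

theorem DihedralGroup.sr_zpow_of_eq_one_or_neg_one {n : ℕ} (i : ZMod n) {e : ℤ}
    (he : e = 1 ∨ e = -1) : DihedralGroup.sr i ^ e = DihedralGroup.sr i := by
  rcases he with rfl | rfl <;> simp


/-- In the free group on two generators `a = FreeGroup.of 0`, `b = FreeGroup.of 1`, no
alternating word `a^{ε₁} b^{δ₁} ⋯ a^{ε_k} b^{δ_k}` (with `k ≥ 1`) belongs to the second
derived subgroup (the derived subgroup of the derived subgroup). -/
theorem alternating_word_not_mem_second_derived
    (k : ℕ) (hk : 1 ≤ k) (ε δ : Fin k → ℤ)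
    (hε : ∀ i, ε i = 1 ∨ ε i = -1) (hδ : ∀ i, δ i = 1 ∨ δ i = -1) :
    (List.ofFn (fun i : Fin k =>
        (FreeGroup.of (0 : Fin 2)) ^ (ε i) * (FreeGroup.of (1 : Fin 2)) ^ (δ i))).prod ∉
      derivedSeries (FreeGroup (Fin 2)) 2 := by
  intro h
  let f : FreeGroup (Fin 2) →* DihedralGroup 0 :=
    FreeGroup.lift ![DihedralGroup.sr 0, DihedralGroup.sr 1]
  have hf := map_derivedSeries_le_derivedSeries f 2 (Subgroup.mem_map_of_mem f h)
  have hstep (i : Fin k) :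
      f (FreeGroup.of 0 ^ ε i * FreeGroup.of 1 ^ δ i) = DihedralGroup.r 1 := by
    simp [f, DihedralGroup.sr_zpow_of_eq_one_or_neg_one _ (hε i),
      DihedralGroup.sr_zpow_of_eq_one_or_neg_one _ (hδ i)]
  rw [DihedralGroup.derivedSeries_two_eq_bot, Subgroup.mem_bot, map_list_prod, List.map_ofFn,
    show f ∘ _ = fun _ => DihedralGroup.r 1 from funext hstep, List.ofFn_const,
    List.prod_replicate, ← orderOf_dvd_iff_pow_eq_one, DihedralGroup.orderOf_r_one,
    zero_dvd_iff] at hf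
  omega
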